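/- arXiv:2004.09041 — 2 statements merged into one kernel-verified Lean document; each statement's English description precedes it below -/
import Mathlib

section
/- Let a, b ∈ ℤ be such that a + b√3 is totally positive. Then a + b√3 is a sum of three squares in O_K (i.e., there exist x, y, z ∈ O_K with x² + y² + z² = a + b√3) if and only if b is even. -/
/-!
Statements about sums of squares in K = ℚ(√3), with ring of integers O_K = ℤ[√3],
realized as `Zsqrtd 3`.
-/

noncomputable section

namespace Paper3

/-- π₂ = 1 + √3 in ℤ[√3]. -/
def pi2 : Zsqrtd 3 := ⟨1, 1⟩

/-- The real embedding of ℤ[√3] sending √3 to √3. -/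
def emb (x : Zsqrtd 3) : ℝ := (x.re : ℝ) + (x.im : ℝ) * Real.sqrt 3

/-- The real embedding of ℤ[√3] sending √3 to −√3. -/
def embConj (x : Zsqrtd 3) : ℝ := (x.re : ℝ) - (x.im : ℝ) * Real.sqrt 3

/-- An element of ℤ[√3] is totally positive if its images under both real embeddings
are positive. -/
def TotPos (x : Zsqrtd 3) : Prop := 0 < emb x ∧ 0 < embConj x

open Matrix Zsqrtd

/-- The value at `v` of the quadratic form with Gram matrix `G`. -/
def qval {ι R : Type*} [Fintype ι] [CommRing R] (G : Matrix ι ι R) (v : ι → R) : R :=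
  v ⬝ᵥ G *ᵥ v

lemma qval_eq_sum {ι R : Type*} [Fintype ι] [CommRing R] (G : Matrix ι ι R) (v : ι → R) :
    qval G v = ∑ i, ∑ j, v i * G i j * v j := by
  simp [qval, dotProduct, mulVec, Finset.mul_sum, mul_assoc]

lemma qval_conj {ι R : Type*} [Fintype ι] [CommRing R] (G U : Matrix ι ι R) (v : ι → R) :
    qval (Uᵀ * G * U) v = qval G (U *ᵥ v) := by
  simp only [qval, ← mulVec_mulVec, dotProduct_mulVec, vecMul_transpose]

lemma qval_smul {ι R : Type*} [Fintype ι] [CommRing R] (G : Matrix ι ι R) (c : R) (v : ι → R) :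
    qval G (c • v) = c ^ 2 * qval G v := by
  simp only [qval, mulVec_smul, dotProduct_smul, smul_dotProduct, smul_eq_mul]; ring

lemma qval_single {ι R : Type*} [Fintype ι] [DecidableEq ι] [CommRing R] (G : Matrix ι ι R)
    (i : ι) : qval G (Pi.single i 1) = G i i := by
  simp [qval]

/-- The Gram matrix of `G 0 0` times the form obtained by projecting away from the first basis
vector. -/
def schur {R : Type*} [CommRing R] {n : ℕ} (G : Matrix (Fin (n + 1)) (Fin (n + 1)) R) :
    Matrix (Fin n) (Fin n) R :=
  of fun i j => G 0 0 * G i.succ j.succ - G 0 i.succ * G 0 j.succ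

lemma schur_isSymm {R : Type*} [CommRing R] {n : ℕ} {G : Matrix (Fin (n + 1)) (Fin (n + 1)) R}
    (hG : G.IsSymm) : (schur G).IsSymm := by
  ext i j
  simp only [schur, transpose_apply, of_apply, hG.apply j.succ i.succ]
  ring

/-- Completing the square with respect to the first variable. -/
lemma mul_qval_cons {R : Type*} [CommRing R] {n : ℕ} {G : Matrix (Fin (n + 1)) (Fin (n + 1)) R}
    (hG : G.IsSymm) (x : R) (w : Fin n → R) :
    G 0 0 * qval G (Fin.cons x w) =
      (G 0 0 * x + ∑ j, G 0 j.succ * w j) ^ 2 + qval (schur G) w := by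
  have h1 : qval G (Fin.cons x w) = x * G 0 0 * x + 2 * x * (∑ j, G 0 j.succ * w j)
      + ∑ i, ∑ j, w i * G i.succ j.succ * w j := by
    rw [qval_eq_sum]
    simp only [Fin.sum_univ_succ, Fin.cons_zero, Fin.cons_succ, Finset.sum_add_distrib]
    have : ∀ i : Fin n, w i * G i.succ 0 * x = x * (G 0 i.succ * w i) := fun i => by
      rw [hG.apply 0 i.succ]; ring
    simp only [this, mul_assoc, ← Finset.mul_sum]
    ring
  have h2 : qval (schur G) w = G 0 0 * ∑ i, ∑ j, w i * G i.succ j.succ * w j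
      - (∑ j, G 0 j.succ * w j) ^ 2 := by
    rw [qval_eq_sum, sq, Finset.sum_mul_sum, Finset.mul_sum, ← Finset.sum_sub_distrib]
    refine Finset.sum_congr rfl fun i _ => ?_
    rw [Finset.mul_sum, ← Finset.sum_sub_distrib]
    refine Finset.sum_congr rfl fun j _ => ?_
    simp only [schur, of_apply]; ring
  rw [h1, h2]; ring

/-- Bordering a matrix by a first column `(a, 0, …, 0)` and a first row `(a, c)`. -/
def border {R : Type*} [CommRing R] {n : ℕ} (a : R) (c : Fin n → R) (M : Matrix (Fin n) (Fin n) R) :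
    Matrix (Fin (n + 1)) (Fin (n + 1)) R :=
  of (Fin.cons (Fin.cons a c) fun i => Fin.cons 0 (M i))

lemma det_border {R : Type*} [CommRing R] {n : ℕ} (a : R) (c : Fin n → R)
    (M : Matrix (Fin n) (Fin n) R) : (border a c M).det = a * M.det := by
  rw [det_succ_column_zero, Fin.sum_univ_succ, Finset.sum_eq_zero]
  · simp only [border, of_apply, Fin.cons_zero, Fin.val_zero, pow_zero, one_mul, add_zero]
    congr 2
  · intro i _
    simp [border]

lemma det_schur {R : Type*} [CommRing R] {n : ℕ} {G : Matrix (Fin (n + 1)) (Fin (n + 1)) R}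
    (hG : G.IsSymm) : G 0 0 * (schur G).det = G 0 0 ^ n * G.det := by
  set L : Matrix (Fin (n + 1)) (Fin (n + 1)) R :=
    (border 1 (fun i => - G 0 i.succ) (diagonal fun _ => G 0 0))ᵀ with hL
  have h : L * G = border (G 0 0) (fun j => G 0 j.succ) (schur G) := by
    ext i j
    rw [mul_apply, Fin.sum_univ_succ]
    refine Fin.cases ?_ (fun i => ?_) i
    · refine Fin.cases ?_ (fun j => ?_) j <;> simp [hL, border]
    · refine Fin.cases ?_ (fun j => ?_) j
      · simp [hL, border, diagonal_apply, hG.apply 0 i.succ]; ring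
      · simp [hL, border, diagonal_apply, schur]; ring
  have := congrArg det h
  rw [det_mul, det_border, hL, det_transpose, det_border] at this
  rw [← this]; simp

/-- **Hermite's bound** on the minimum of a positive definite integral quadratic form. -/
theorem hermite_bound (n : ℕ) (A : Matrix (Fin (n + 1)) (Fin (n + 1)) ℤ) (hs : A.IsSymm)
    (hp : ∀ v ≠ 0, 0 < qval A v) :
    ∃ U : Matrix (Fin (n + 1)) (Fin (n + 1)) ℤ, U.det ^ 2 = 1 ∧
      3 ^ (∑ i ∈ Finset.range (n + 1), i) * (qval A fun i => U i 0) ^ (n + 1) ≤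
        4 ^ (∑ i ∈ Finset.range (n + 1), i) * A.det := by
  induction n with
  | zero =>
    refine ⟨1, by simp, ?_⟩
    simp [qval_eq_sum]
  | succ n ih =>
    let S : Set (Matrix (Fin (n + 2)) (Fin (n + 2)) ℤ) := {U | U.det ^ 2 = 1}
    have hS : S.Nonempty := ⟨1, by simp [S]⟩
    obtain ⟨U, hU, hmin⟩ : ∃ U ∈ S, ∀ V ∈ S,
        (qval A fun i => U i 0).toNat ≤ (qval A fun i => V i 0).toNat :=
      ⟨Function.argminOn (fun U => (qval A fun i => U i 0).toNat) S hS,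
        Function.argminOn_mem _ _ _, fun V hV =>
          Function.argminOn_le (fun U => (qval A fun i => U i 0).toNat) S hV⟩
    replace hU : U.det ^ 2 = 1 := hU
    have hinj : ∀ {V : Matrix (Fin (n + 2)) (Fin (n + 2)) ℤ}, V.det ^ 2 = 1 → ∀ v ≠ 0,
        V *ᵥ v ≠ 0 := by
      intro V hV v hv h
      refine hv (eq_zero_of_mulVec_eq_zero ?_ h)
      rintro h0; simp [h0] at hV
    have hcol : ∀ V : Matrix (Fin (n + 2)) (Fin (n + 2)) ℤ,
        (fun i => V i 0) = V *ᵥ Pi.single 0 1 := fun V => by simp; rfl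
    set B := Uᵀ * A * U with hB
    have hBs : B.IsSymm := by
      simp [hB, IsSymm, transpose_mul, hs.eq, Matrix.mul_assoc]
    have hBdet : B.det = A.det := by
      rw [hB, det_mul, det_mul, det_transpose]; linear_combination A.det * hU
    have hBp : ∀ v ≠ 0, 0 < qval B v := fun v hv => by
      rw [hB, qval_conj]; exact hp _ (hinj hU v hv)
    set α := B 0 0 with hα
    have hα0 : α = qval A fun i => U i 0 := by
      rw [hα, ← qval_single B, hB, qval_conj, hcol]
    have hαpos : 0 < α := by
      rw [hα, ← qval_single B]
      exact hBp _ (by simp)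
    have hgp : ∀ w ≠ 0, 0 < qval (schur B) w := by
      intro w hw
      have h := mul_qval_cons hBs (-∑ j, B 0 j.succ * w j) (α • w)
      have e : ∑ j, B 0 j.succ * (α • w) j = α * ∑ j, B 0 j.succ * w j := by
        rw [Finset.mul_sum]; refine Finset.sum_congr rfl fun j _ => ?_
        simp only [Pi.smul_apply, smul_eq_mul]; ring
      rw [e, qval_smul, ← hα] at h
      have hpos : 0 < qval B (Fin.cons (-∑ j, B 0 j.succ * w j) (α • w)) := by
        apply hBp
        intro h0
        apply hw
        funext j
        have := congrFun h0 j.succ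
        simpa [hαpos.ne'] using this
      have : 0 < α ^ 2 * qval (schur B) w := by
        have := mul_pos hαpos hpos
        rw [h] at this
        linarith [this, show (α * -∑ j, B 0 j.succ * w j + α * ∑ j, B 0 j.succ * w j) ^ 2 = 0 by ring]
      exact pos_of_mul_pos_right this (by positivity)
    obtain ⟨U', hU', hle⟩ := ih (schur B) (schur_isSymm hBs) hgp
    set w : Fin (n + 1) → ℤ := fun i => U' i 0 with hw
    set γ := qval (schur B) w with hγ
    set β := ∑ j, B 0 j.succ * w j with hβ
    obtain ⟨x, hx⟩ : ∃ x : ℤ, 4 * (α * x + β) ^ 2 ≤ α ^ 2 := by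
      refine ⟨-((2 * β + α) / (2 * α)), ?_⟩
      have h1 := Int.emod_nonneg (2 * β + α) (b := 2 * α) (by positivity)
      have h2 := Int.emod_lt_of_pos (2 * β + α) (b := 2 * α) (by positivity)
      have h3 := Int.emod_add_mul_ediv (2 * β + α) (2 * α)
      set k := (2 * β + α) / (2 * α)
      have h4 : -α ≤ 2 * (α * -k + β) := by nlinarith
      have h5 : 2 * (α * -k + β) ≤ α := by nlinarith
      nlinarith
    let W := border 1 (Fin.cons x 0) U'
    let V := W.submatrix id (Equiv.swap (0 : Fin (n + 2)) 1)
    have hV : V.det ^ 2 = 1 := by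
      have : V.det ^ 2 = U'.det ^ 2 := by
        simp only [V, W, det_permute', det_border, one_mul, mul_pow]
        rcases Int.units_eq_one_or (Equiv.Perm.sign (Equiv.swap (0 : Fin (n + 2)) 1)) with h | h <;>
          simp [h]
      rw [this, hU']
    have hVcol : (fun i => V i 0) = Fin.cons x w := by
      funext i
      refine Fin.cases ?_ (fun i => ?_) i
      · simp only [V, W, border, submatrix_apply, id, Equiv.swap_apply_left, of_apply, Fin.cons_zero]
        exact (Fin.cons_succ (α := fun _ => ℤ) 1 (Fin.cons x 0) 0)
      · simp only [V, W, border, submatrix_apply, id, Equiv.swap_apply_left, of_apply, Fin.cons_succ]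
        exact (Fin.cons_succ (α := fun _ => ℤ) 0 (U' i) 0)
    have hge : α ≤ qval B (Fin.cons x w) := by
      have h1 := hmin (U * V) (by
        change (U * V).det ^ 2 = 1
        rw [det_mul, mul_pow, hU, hV, one_mul])
      have h2 : (qval A fun i => (U * V) i 0) = qval B (Fin.cons x w) := by
        rw [hB, qval_conj, ← hVcol, hcol, hcol, mulVec_mulVec]
      rw [h2, ← hα0] at h1
      omega
    have hsq := mul_qval_cons hBs x w
    rw [← hα, ← hβ, ← hγ] at hsq
    have h43 : 3 * α ^ 2 ≤ 4 * γ := by nlinarith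
    have hdet := det_schur hBs
    rw [← hα, hBdet] at hdet
    have hdet' : (schur B).det = α ^ n * A.det := by
      apply mul_left_cancel₀ hαpos.ne'
      rw [hdet]; ring
    refine ⟨U, hU, ?_⟩
    rw [← hα0, Finset.sum_range_succ]
    set T := ∑ i ∈ Finset.range (n + 1), i
    rw [hdet'] at hle
    have h5 : (3 * α ^ 2) ^ (n + 1) ≤ (4 * γ) ^ (n + 1) := by gcongr
    refine le_of_mul_le_mul_left ?_ (pow_pos hαpos n)
    calc α ^ n * (3 ^ (T + (n + 1)) * α ^ (n + 1 + 1)) = 3 ^ T * (3 * α ^ 2) ^ (n + 1) := by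
          rw [mul_pow]; ring
      _ ≤ 3 ^ T * (4 * γ) ^ (n + 1) := by gcongr
      _ = 4 ^ (n + 1) * (3 ^ T * γ ^ (n + 1)) := by rw [mul_pow]; ring
      _ ≤ 4 ^ (n + 1) * (4 ^ T * (α ^ n * A.det)) := by gcongr
      _ = _ := by ring

lemma sqrt_three_mul_self : Real.sqrt 3 * Real.sqrt 3 = 3 := Real.mul_self_sqrt (by norm_num)

lemma emb_add (x y : ℤ√3) : emb (x + y) = emb x + emb y := by simp [emb]; ring

lemma embConj_add (x y : ℤ√3) : embConj (x + y) = embConj x + embConj y := by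
  simp [embConj]; ring

lemma emb_mul (x y : ℤ√3) : emb (x * y) = emb x * emb y := by
  simp only [emb, re_mul, im_mul]; push_cast
  linear_combination -(x.im * y.im : ℝ) * sqrt_three_mul_self

lemma embConj_mul (x y : ℤ√3) : embConj (x * y) = embConj x * embConj y := by
  simp only [embConj, re_mul, im_mul]; push_cast
  linear_combination -(x.im * y.im : ℝ) * sqrt_three_mul_self

lemma emb_mul_embConj (x : ℤ√3) : emb x * embConj x = x.norm := by
  simp only [emb, embConj, norm_def]; push_cast
  linear_combination -(x.im * x.im : ℝ) * sqrt_three_mul_self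

lemma norm_eq_zero_iff' {x : ℤ√3} : x.norm = 0 ↔ x = 0 := by
  refine Zsqrtd.norm_eq_zero (fun n hn => ?_) x
  have : n ≤ 1 := by nlinarith
  have : -1 ≤ n := by nlinarith
  interval_cases n <;> omega

instance : IsDomain (ℤ√3) :=
  have : NoZeroDivisors (ℤ√3) := ⟨fun {x y} h => by
    have h' := congrArg Zsqrtd.norm h
    rw [norm_mul, Zsqrtd.norm_zero, mul_eq_zero] at h'
    simpa only [norm_eq_zero_iff'] using h'⟩
  NoZeroDivisors.to_isDomain _

lemma totPos_iff {x : ℤ√3} : TotPos x ↔ 0 < x.re ∧ 0 < x.norm := by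
  have h1 := emb_mul_embConj x
  have h2 : emb x + embConj x = 2 * x.re := by simp only [emb, embConj]; ring
  constructor
  · rintro ⟨ha, hb⟩
    have h3 : (0 : ℝ) < x.norm := h1 ▸ mul_pos ha hb
    have h4 : (0 : ℝ) < x.re := by linarith
    exact ⟨by exact_mod_cast h4, by exact_mod_cast h3⟩
  · rintro ⟨ha, hb⟩
    have h3 : (0 : ℝ) < emb x * embConj x := by rw [h1]; exact_mod_cast hb
    have h4 : (0 : ℝ) < emb x + embConj x := by
      rw [h2]; exact_mod_cast (by positivity : 0 < 2 * x.re)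
    rcases pos_and_pos_or_neg_and_neg_of_mul_pos h3 with h | h
    · exact h
    · linarith [h.1, h.2]

lemma TotPos.ne_zero {x : ℤ√3} (h : TotPos x) : x ≠ 0 := by
  rintro rfl; simp [TotPos, emb] at h

lemma TotPos.mul {x y : ℤ√3} (hx : TotPos x) (hy : TotPos y) : TotPos (x * y) :=
  ⟨emb_mul x y ▸ mul_pos hx.1 hy.1, embConj_mul x y ▸ mul_pos hx.2 hy.2⟩

lemma TotPos.of_mul {x y : ℤ√3} (hx : TotPos x) (h : TotPos (x * y)) : TotPos y :=
  ⟨pos_of_mul_pos_right (emb_mul x y ▸ h.1) hx.1.le,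
    pos_of_mul_pos_right (embConj_mul x y ▸ h.2) hx.2.le⟩

lemma TotPos.add {x y : ℤ√3} (hx : TotPos x) (hy : TotPos y) : TotPos (x + y) :=
  ⟨emb_add x y ▸ add_pos hx.1 hy.1, embConj_add x y ▸ add_pos hx.2 hy.2⟩

lemma totPos_sq {x : ℤ√3} (hx : x ≠ 0) : TotPos (x ^ 2) := by
  have h : emb x * embConj x ≠ 0 := by
    rw [emb_mul_embConj]; exact_mod_cast norm_eq_zero_iff'.not.mpr hx
  rw [sq]
  exact ⟨emb_mul x x ▸ mul_self_pos.2 (left_ne_zero_of_mul h),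
    embConj_mul x x ▸ mul_self_pos.2 (right_ne_zero_of_mul h)⟩

lemma even_im_sq (x : ℤ√3) : Even (x ^ 2).im := ⟨x.re * x.im, by simp [sq]; ring⟩

lemma even_im_mul {x y : ℤ√3} (hx : Even x.im) (hy : Even y.im) : Even (x * y).im := by
  rw [im_mul]; exact (hy.mul_left _).add (hx.mul_right _)

/-- Division with remainder in `ℤ[√3]`, which is Euclidean for the norm. -/
lemma exists_norm_sub_lt (x y : ℤ√3) (hy : y ≠ 0) :
    ∃ k, (x - k * y).norm.natAbs < y.norm.natAbs := by
  have hN : y.norm ≠ 0 := norm_eq_zero_iff'.not.2 hy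
  have rnd : ∀ (z : ℤ) {N : ℤ}, N ≠ 0 → ∃ k, 4 * (z - k * N) ^ 2 ≤ N ^ 2 := by
    intro z N hN
    refine ⟨(2 * z + |N|) / (2 * |N|) * N.sign, ?_⟩
    have hpos := abs_pos.2 hN
    have h1 := Int.emod_nonneg (2 * z + |N|) (b := 2 * |N|) (by positivity)
    have h2 := Int.emod_lt_of_pos (2 * z + |N|) (b := 2 * |N|) (by positivity)
    have h3 := Int.emod_add_mul_ediv (2 * z + |N|) (2 * |N|)
    rw [mul_assoc, Int.sign_mul_self_eq_abs, ← sq_abs N]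
    set k := (2 * z + |N|) / (2 * |N|)
    nlinarith
  obtain ⟨k, hk⟩ := rnd (x * star y).re hN
  obtain ⟨l, hl⟩ := rnd (x * star y).im hN
  refine ⟨⟨k, l⟩, ?_⟩
  have h1 : (x - ⟨k, l⟩ * y).norm * y.norm =
      ((x * star y).re - k * y.norm) ^ 2 - 3 * ((x * star y).im - l * y.norm) ^ 2 := by
    simp only [norm_def, re_sub, im_sub, re_mul, im_mul, re_star, im_star]; ring
  set r := (x - ⟨k, l⟩ * y).norm
  set N := y.norm
  have h2 : (r * N) ^ 2 < (N * N) ^ 2 := by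
    have hp : 0 < N ^ 2 := by positivity
    apply sq_lt_sq.2
    rw [abs_of_nonneg (mul_self_nonneg N), abs_lt, h1]
    constructor <;> nlinarith
  have h3 : r ^ 2 < N ^ 2 := by
    have hp : 0 < N ^ 2 := by positivity
    nlinarith
  zify; exact sq_lt_sq.1 h3

/-- `ℤ[√3]` is a Bézout domain. -/
lemma exists_bezout (x y : ℤ√3) : ∃ d p r s w : ℤ√3, x = d * p ∧ y = d * r ∧ p * s + r * w = 1 := by
  induction h : y.norm.natAbs using Nat.strong_induction_on generalizing x y with
  | _ n ih =>
    by_cases hy : y = 0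
    · exact ⟨x, 1, 0, 1, 0, by simp, by simp [hy], by simp⟩
    · obtain ⟨k, hk⟩ := exists_norm_sub_lt x y hy
      obtain ⟨d, p, r, s, w, h1, h2, h3⟩ := ih _ (h ▸ hk) y (x - k * y) rfl
      exact ⟨d, k * p + r, p, w, s - k * w, by linear_combination h2 + k * h1, h1,
        by linear_combination h3⟩

lemma isSquare_mul_of_not_isSquare {q : ℕ} [Fact q.Prime] {a b : ZMod q} (ha : ¬ IsSquare a)
    (hb : ¬ IsSquare b) : IsSquare (a * b) := by
  have ha0 : a ≠ 0 := fun h => ha (h ▸ IsSquare.zero)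
  have hb0 : b ≠ 0 := fun h => hb (h ▸ IsSquare.zero)
  rw [← quadraticChar_one_iff_isSquare (mul_ne_zero ha0 hb0), map_mul,
    quadraticChar_neg_one_iff_not_isSquare.2 ha, quadraticChar_neg_one_iff_not_isSquare.2 hb]
  norm_num

/-- If `3` is not a square modulo `q`, an element of `𝔽_q(√3)` whose norm is a square in `𝔽_q` is
a square. -/
lemma exists_sqrt_of_norm_eq_sq {q : ℕ} [Fact q.Prime] (h2 : (2 : ZMod q) ≠ 0)
    (h3 : ¬ IsSquare (3 : ZMod q)) {u v s : ZMod q} (h : u ^ 2 - 3 * v ^ 2 = s ^ 2) :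
    ∃ x y : ZMod q, x ^ 2 + 3 * y ^ 2 = u ∧ 2 * x * y = v := by
  have h30 : (3 : ZMod q) ≠ 0 := fun h => h3 (h ▸ IsSquare.zero)
  by_cases hv : v = 0
  · by_cases hu : IsSquare u
    · obtain ⟨r, rfl⟩ := hu
      exact ⟨r, 0, by ring, by simp [hv]⟩
    · obtain ⟨r, hr⟩ := isSquare_mul_of_not_isSquare h3 hu
      refine ⟨0, r / 3, ?_, by simp [hv]⟩
      field_simp
      linear_combination -hr
  · have key : ∀ σ : ZMod q, σ ^ 2 = s ^ 2 → IsSquare ((u + σ) / 2) →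
        ∃ x y : ZMod q, x ^ 2 + 3 * y ^ 2 = u ∧ 2 * x * y = v := by
      rintro σ hσ ⟨x, hx⟩
      have hx' : u + σ = 2 * x ^ 2 := by rw [div_eq_iff h2] at hx; linear_combination hx
      have hx0 : x ≠ 0 := by
        rintro rfl
        have : 3 * v ^ 2 = 0 := by
          have : u = -σ := by linear_combination hx'
          linear_combination -h + hσ + (u - σ) * this
        simp_all
      refine ⟨x, v / (2 * x), ?_, by field_simp⟩
      field_simp
      have : 3 * v ^ 2 = (2 * x ^ 2) * (u - σ) := by rw [← hx']; linear_combination -h + hσ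
      linear_combination this - 2 * x ^ 2 * hx'
    by_cases hs : IsSquare ((u + s) / 2)
    · exact key s rfl hs
    · refine key (-s) (by ring) ?_
      by_contra hs'
      obtain ⟨r, hr⟩ := isSquare_mul_of_not_isSquare hs hs'
      apply h3
      refine ⟨2 * r / v, ?_⟩
      field_simp
      field_simp at hr
      linear_combination hr - h

lemma odd_part_norm_mod_four (e : ℕ) : ∀ x y w : ℤ, x ^ 2 - 3 * y ^ 2 = 2 ^ e * w → Odd w →
    4 ∣ w - (-1) ^ e := by
  induction e with
  | zero =>
    rintro x y w h ⟨k, rfl⟩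
    rcases Int.even_or_odd' x with ⟨c, rfl | rfl⟩ <;> rcases Int.even_or_odd' y with ⟨d, rfl | rfl⟩ <;>
      ring_nf at h ⊢ <;> omega
  | succ e ih =>
    intro x y w h hw
    have hxy : Even (x - y) := by
      have h1 : Even (x ^ 2 - 3 * y ^ 2) := ⟨2 ^ e * w, by rw [h]; ring⟩
      have h2 : ¬ Even (3 : ℤ) := by decide
      simpa [Int.even_sub, Int.even_pow, Int.even_mul, h2] using h1
    obtain ⟨d, hd⟩ := hxy
    have := ih (y - d) d (-w) (by
      have hx : x = y + 2 * d := by linarith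
      subst hx
      apply mul_left_cancel₀ (two_ne_zero (α := ℤ))
      rw [pow_succ] at h
      linear_combination -h) hw.neg
    obtain ⟨k, hk⟩ := this
    exact ⟨-k, by rw [pow_succ]; linear_combination -hk⟩

/-- The auxiliary prime: it is `-1/3` modulo a high power of two and `-1` modulo `3` and modulo the
odd part of `N`. -/
lemma exists_prime_congr {N : ℕ} (hN : N ≠ 0) : ∃ (q : ℕ) (e w : ℕ) (t : ℤ), q.Prime ∧
    N = 2 ^ e * w ∧ Odd w ∧ q % 8 = 5 ∧ q % 3 = 2 ∧ (w : ℤ) ∣ q + 1 ∧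
    (24 * N : ℤ) ∣ 1 + q * ((1 - t) ^ 2 + 3 * t ^ 2) ∧ (24 * N : ℤ) ∣ t * (1 - t) := by
  obtain ⟨e, w, hw, rfl⟩ := Nat.exists_eq_two_pow_mul_odd hN
  have hco : Nat.Coprime (2 ^ (e + 3)) (3 * w) :=
    Nat.Coprime.pow_left _ (Nat.coprime_two_left.2 (Odd.mul (by decide) hw))
  have hco3 : Nat.Coprime 3 (2 ^ (e + 3)) := Nat.Coprime.pow_right _ (by decide)
  obtain ⟨i, hi⟩ : ∃ i : ℤ, ((2 ^ (e + 3) : ℕ) : ℤ) ∣ 3 * i + 1 := by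
    have h := Nat.isCoprime_iff_coprime.2 hco3
    obtain ⟨a, b, hab⟩ := h
    refine ⟨-a, b, ?_⟩
    push_cast at hab ⊢
    linear_combination -hab
  have hcoZ : IsCoprime ((2 ^ (e + 3) : ℕ) : ℤ) ((3 * w : ℕ) : ℤ) := Nat.isCoprime_iff_coprime.2 hco
  obtain ⟨a, b, hab⟩ := hcoZ
  set P : ℤ := ((2 ^ (e + 3) : ℕ) : ℤ) with hP
  set M : ℤ := ((3 * w : ℕ) : ℤ) with hM
  have hPM : (24 * ((2 ^ e * w : ℕ) : ℤ)) = P * M := by rw [hP, hM]; push_cast; ring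
  set c : ℤ := i * (b * M) - a * P with hc
  have hcP : P ∣ 3 * c + 1 := by
    obtain ⟨k, hk⟩ := hi
    exact ⟨k - (3 * i + 3) * a, by rw [hc]; linear_combination hk + 3 * i * hab⟩
  have hcM : M ∣ c + 1 := ⟨i * b + b, by rw [hc]; linear_combination -hab⟩
  have hcop : IsCoprime c ((2 ^ (e + 3) * (3 * w) : ℕ) : ℤ) := by
    rw [Nat.cast_mul]
    obtain ⟨k, hk⟩ := hcP
    obtain ⟨l, hl⟩ := hcM
    exact IsCoprime.mul_right ⟨-3, k, by linear_combination -hk⟩ ⟨-1, l, by linear_combination -hl⟩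
  obtain ⟨q, -, hq, hqc⟩ := Nat.forall_exists_prime_gt_and_zmodEq 0
    (by have := hw.pos; positivity) hcop
  have hd := hqc.symm.dvd
  rw [Nat.cast_mul, ← hP, ← hM] at hd
  obtain ⟨k, hk⟩ := hd
  have hqP : P ∣ 3 * q + 1 := by
    obtain ⟨j, hj⟩ := hcP
    exact ⟨j + 3 * M * k, by linear_combination hj + 3 * hk⟩
  have hqM : M ∣ q + 1 := by
    obtain ⟨j, hj⟩ := hcM
    exact ⟨j + P * k, by linear_combination hj + hk⟩
  have h8 : (8 : ℤ) ∣ 3 * q + 1 := 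
    (Dvd.intro (2 ^ e : ℤ) (by rw [hP]; push_cast; ring) : (8 : ℤ) ∣ P).trans hqP
  have h3 : (3 : ℤ) ∣ q + 1 := 
    (Dvd.intro (w : ℤ) (by rw [hM]; push_cast; ring) : (3 : ℤ) ∣ M).trans hqM
  have hwq : (w : ℤ) ∣ q + 1 := 
    (Dvd.intro 3 (by rw [hM]; push_cast; ring) : (w : ℤ) ∣ M).trans hqM
  have htt : P * M ∣ (b * M) * (1 - b * M) := ⟨a * b, by linear_combination (-(b * M)) * hab⟩
  refine ⟨q, e, w, b * M, hq, rfl, hw, by omega, by omega, hwq, ?_, ?_⟩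
  · rw [hPM]
    refine IsCoprime.mul_dvd ⟨a, b, hab⟩ ?_ ?_
    · obtain ⟨j, hj⟩ := hqP
      refine ⟨j + q * (a ^ 2 * P + 3 * a * (- 2 + a * P)), ?_⟩
      have : b * M = 1 - a * P := by linear_combination hab
      rw [this]; linear_combination hj
    · obtain ⟨j, hj⟩ := hqM
      exact ⟨j + q * (-2 * b + b ^ 2 * M + 3 * b ^ 2 * M), by linear_combination hj⟩
  · rw [hPM]; exact htt

lemma jacobiSym_eq_one_of_norm {q e w : ℕ} {x y : ℤ} (hw : Odd w) (h8 : q % 8 = 5)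
    (hwq : (w : ℤ) ∣ q + 1) (hN : x ^ 2 - 3 * y ^ 2 = ((2 ^ e * w : ℕ) : ℤ)) :
    jacobiSym ((2 ^ e * w : ℕ) : ℤ) q = 1 := by
  have hqo : Odd q := Nat.odd_iff.2 (by omega)
  have h4 := odd_part_norm_mod_four e x y w (by rw [hN]; push_cast; ring) (by exact_mod_cast hw)
  have h2 : jacobiSym 2 q = -1 := by
    rw [jacobiSym.at_two hqo, ZMod.χ₈_nat_mod_eight, h8]; rfl
  have hwq' : jacobiSym w q = (-1) ^ e := by
    have hmod : (q : ℤ) % w = -1 % w :=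
      Int.emod_eq_emod_iff_emod_sub_eq_zero.2 (Int.emod_eq_zero_of_dvd (by simpa using hwq))
    rw [jacobiSym.quadratic_reciprocity_one_mod_four' hw (by omega), jacobiSym.mod_left' hmod,
      jacobiSym.at_neg_one hw]
    rcases Nat.even_or_odd e with he | he
    · rw [he.neg_one_pow] at h4 ⊢
      exact ZMod.χ₄_nat_one_mod_four (by omega)
    · rw [he.neg_one_pow] at h4 ⊢
      exact ZMod.χ₄_nat_three_mod_four (by omega)
  push_cast
  rw [jacobiSym.mul_left, jacobiSym.pow_left, h2, hwq', ← mul_pow]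
  norm_num

/-- The data of a unimodular ternary lattice containing a vector of norm `n`. -/
lemma exists_auxiliary {n : ℤ√3} (hn : TotPos n) :
    ∃ (q : ℕ) (t b a c : ℤ√3), Odd q ∧ n * b = 1 + q * t ^ 2 ∧ Even b.im ∧ TotPos b ∧
      a ^ 2 + b = q * c := by
  have hnorm := (totPos_iff.1 hn).2
  obtain ⟨N, hN⟩ := Int.eq_ofNat_of_zero_le hnorm.le
  have hN0 : N ≠ 0 := by rintro rfl; simp [hN] at hnorm
  obtain ⟨q, e, w, t, hq, hNw, hw, h8, h3, hwq, ⟨k, hk⟩, ⟨l, hl⟩⟩ := exists_prime_congr hN0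
  have : Fact q.Prime := ⟨hq⟩
  have hqo : Odd q := Nat.odd_iff.2 (by omega)
  set τ : ℤ√3 := ⟨1 - t, t⟩ with hτ
  set s : ℤ√3 := ⟨k, 2 * q * l⟩ with hs
  have hNs : (1 : ℤ√3) + q * τ ^ 2 = (24 * N : ℤ) * s := by
    ext
    · simp [hτ, hs, sq]; linear_combination hk
    · simp [hτ, hs, sq]; linear_combination 2 * (q : ℤ) * hl
  set b : ℤ√3 := 24 * (star n * s) with hb
  have hnb : n * b = 1 + q * τ ^ 2 := by
    have h := norm_eq_mul_conj n
    rw [hNs, hb]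
    rw [hN] at h
    push_cast at h ⊢
    linear_combination (-24 * s) * h
  have hbe : Even b.im := ⟨12 * (star n * s).im, by rw [hb]; simp; ring⟩
  have hτ0 : τ ≠ 0 := by
    intro h0
    have h1 := congrArg Zsqrtd.re h0
    have h2 := congrArg Zsqrtd.im h0
    simp [hτ] at h1 h2
    omega
  have hpos : TotPos (1 + q * τ ^ 2) := by
    refine TotPos.add (by simp [TotPos, emb, embConj]) (TotPos.mul ?_ (totPos_sq hτ0))
    simpa [TotPos, emb, embConj] using hq.pos
  have hbp : TotPos b := TotPos.of_mul hn (hnb ▸ hpos)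
  have hsq : IsSquare ((N : ℤ) : ZMod q) := by
    apply ZMod.isSquare_of_jacobiSym_eq_one
    rw [hNw]
    refine jacobiSym_eq_one_of_norm hw h8 hwq (x := n.re) (y := n.im) ?_
    rw [← hNw, ← hN, norm_def]; ring
  have h3q : ¬ IsSquare (3 : ZMod q) := by
    have : jacobiSym 3 q = -1 := by
      have h1 := jacobiSym.quadratic_reciprocity_one_mod_four' (a := 3) (b := q) (by decide) (by omega)
      rw [jacobiSym.mod_left (q : ℤ) 3, show (q : ℤ) % (3 : ℕ) = 2 by omega] at h1
      push_cast at h1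
      rw [h1, jacobiSym.at_two (by decide)]; rfl
    have := ZMod.nonsquare_of_jacobiSym_eq_neg_one this
    simpa using this
  have h2q : (2 : ZMod q) ≠ 0 := by
    have : ((2 : ℕ) : ZMod q) ≠ 0 := by
      rw [Ne, ZMod.natCast_eq_zero_iff]
      intro h
      have := Nat.le_of_dvd (by norm_num) h
      interval_cases q <;> omega
    exact_mod_cast this
  have hNb : ((N : ℤ) : ZMod q) * ((-b).norm : ℤ) = 1 := by
    have h1 : (N : ℤ) * (-b).norm = 1 + q * (2 * (τ ^ 2).re + q * (τ ^ 2).norm) := by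
      rw [Zsqrtd.norm_neg]
      have h2 := congrArg Zsqrtd.norm hnb
      rw [norm_mul, hN] at h2
      rw [h2]
      simp only [norm_def, re_add, im_add, re_mul, im_mul, re_one, im_one, re_natCast, im_natCast]
      ring
    have := congrArg (Int.cast : ℤ → ZMod q) h1
    push_cast at this ⊢
    rw [this]; simp
  obtain ⟨r, hr⟩ := hsq
  have hr0 : r ≠ 0 := by
    rintro rfl
    rw [hr] at hNb
    simp at hNb
  obtain ⟨x, y, hx, hy⟩ := exists_sqrt_of_norm_eq_sq h2q h3q
    (u := ((-b).re : ℤ)) (v := ((-b).im : ℤ)) (s := 1 / r) (by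
      rw [hr] at hNb
      rw [norm_def] at hNb
      push_cast at hNb ⊢
      field_simp
      linear_combination hNb)
  obtain ⟨x', rfl⟩ := ZMod.intCast_surjective x
  obtain ⟨y', rfl⟩ := ZMod.intCast_surjective y
  have hdvd : ((q : ℤ) : ℤ√3) ∣ ⟨x', y'⟩ ^ 2 + b := by
    rw [Zsqrtd.intCast_dvd]
    constructor <;> rw [← ZMod.intCast_zmod_eq_zero_iff_dvd] <;>
      simp only [re_neg, im_neg, sq, re_add, im_add, re_mul, im_mul] at hx hy ⊢ <;>
      push_cast at hx hy ⊢
    · linear_combination hx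
    · linear_combination hy
  obtain ⟨c, hc⟩ := hdvd
  exact ⟨q, τ, b, ⟨x', y'⟩, c, hqo, hnb, hbe, hbp, by simpa using hc⟩

/-- The Gram matrix over `ℤ` of the real part of the quadratic form with Gram matrix `G`. -/
def reGram {n : ℕ} (G : Matrix (Fin n) (Fin n) (ℤ√3)) : Matrix (Fin n ⊕ Fin n) (Fin n ⊕ Fin n) ℤ :=
  fromBlocks (of fun i j => (G i j).re) (of fun i j => 3 * (G i j).im)
    (of fun i j => 3 * (G i j).im) (of fun i j => 3 * (G i j).re)

lemma reGram_isSymm {n : ℕ} {G : Matrix (Fin n) (Fin n) (ℤ√3)} (hG : G.IsSymm) :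
    (reGram G).IsSymm := by
  refine IsSymm.fromBlocks ?_ ?_ ?_ <;> ext i j <;> simp [hG.apply i j]

lemma qval_reGram {n : ℕ} (G : Matrix (Fin n) (Fin n) (ℤ√3)) (v : Fin n ⊕ Fin n → ℤ) :
    qval (reGram G) v = (qval G fun i => ⟨v (.inl i), v (.inr i)⟩).re := by
  have hre : ∀ f : Fin n → ℤ√3, (∑ i, f i).re = ∑ i, (f i).re := fun f =>
    map_sum (⟨⟨Zsqrtd.re, rfl⟩, fun _ _ => rfl⟩ : ℤ√3 →+ ℤ) f Finset.univ
  rw [qval_eq_sum, qval_eq_sum, hre]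
  simp only [Fintype.sum_sum_type, hre, reGram, fromBlocks_apply₁₁, fromBlocks_apply₁₂,
    fromBlocks_apply₂₁, fromBlocks_apply₂₂, of_apply, ← Finset.sum_add_distrib, re_mul, im_mul]
  refine Finset.sum_congr rfl fun i _ => Finset.sum_congr rfl fun j _ => ?_
  ring

lemma det_reGram {n : ℕ} (G : Matrix (Fin n) (Fin n) (ℤ√3)) :
    (reGram G).det = 3 ^ n * G.det.norm := by
  set s : ℤ√3 := ⟨0, 1⟩ with hs
  have hs2 : s * s = 3 := by ext <;> simp [hs]
  set A : Matrix (Fin n) (Fin n) (ℤ√3) := of fun i j => ((G i j).re : ℤ√3) with hA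
  set B : Matrix (Fin n) (Fin n) (ℤ√3) := of fun i j => ((G i j).im : ℤ√3) with hB
  have hG : A + s • B = G := by
    ext i j <;> simp [hA, hB, hs]
  have hG' : A - s • B = G.map (starRingEnd (ℤ√3)) := by
    ext i j <;> simp [hA, hB, hs, starRingEnd_apply]
  have h1 : (reGram G).map (Int.castRingHom (ℤ√3)) =
      fromBlocks 1 0 0 (diagonal fun _ => 3) * fromBlocks A ((3 : ℤ√3) • B) B A := by
    rw [reGram, fromBlocks_map, fromBlocks_multiply]
    congr 1 <;> ext i j <;> simp [hA, hB]
  have h2 : fromBlocks 1 (s • 1) 0 1 * fromBlocks A ((3 : ℤ√3) • B) B A *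
      fromBlocks 1 (-(s • 1)) 0 1 = fromBlocks (A + s • B) 0 B (A - s • B) := by
    rw [fromBlocks_multiply, fromBlocks_multiply]
    congr 1
    · simp
    · simp only [Matrix.one_mul, Matrix.smul_mul, Matrix.mul_one, Matrix.mul_neg,
        Matrix.mul_smul, ← hs2, mul_smul, smul_add]
      abel
    · simp
    · simp [sub_eq_add_neg, add_comm]
  have h3 : (fromBlocks A ((3 : ℤ√3) • B) B A).det = G.det * star G.det := by
    have h := congrArg det h2
    rw [det_mul, det_mul, det_fromBlocks_zero₂₁, det_fromBlocks_zero₂₁, det_fromBlocks_zero₁₂, hG,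
      hG'] at h
    simp only [det_one, mul_one, one_mul] at h
    rw [h]
    congr 1
    exact (RingHom.map_det (starRingEnd (ℤ√3)) G).symm
  have h4 : (((reGram G).det : ℤ) : ℤ√3) = ((3 ^ n * G.det.norm : ℤ) : ℤ√3) := by
    have := RingHom.map_det (Int.castRingHom (ℤ√3)) (reGram G)
    rw [eq_intCast] at this
    rw [this, RingHom.mapMatrix_apply, h1, det_mul, h3, det_fromBlocks_zero₂₁, det_diagonal,
      ← norm_eq_mul_conj]
    simp
  exact_mod_cast h4

lemma exists_re_qval_le {n m : ℕ} (hnm : n + n = m + 1) {G : Matrix (Fin n) (Fin n) (ℤ√3)}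
    (hG : G.IsSymm) (hp : ∀ v ≠ 0, TotPos (qval G v)) : ∃ v ≠ 0,
      3 ^ (∑ i ∈ Finset.range (m + 1), i) * (qval G v).re ^ (m + 1) ≤
        4 ^ (∑ i ∈ Finset.range (m + 1), i) * (3 ^ n * G.det.norm) := by
  set e : Fin (m + 1) ≃ Fin n ⊕ Fin n := (finSumFinEquiv.trans (finCongr hnm)).symm
  have hq : ∀ v, qval ((reGram G).submatrix e e) v =
      (qval G fun i => ⟨v (e.symm (.inl i)), v (e.symm (.inr i))⟩).re := by
    intro v
    rw [← qval_reGram G fun i => v (e.symm i)]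
    change _ = qval (reGram G) (v ∘ e.symm)
    rw [qval, qval, submatrix_mulVec_equiv, dotProduct_comp_equiv_symm]
    rfl
  have h0 : ∀ v : Fin (m + 1) → ℤ, v ≠ 0 →
      (fun i => ⟨v (e.symm (.inl i)), v (e.symm (.inr i))⟩ : Fin n → ℤ√3) ≠ 0 := by
    intro v hv h
    apply hv
    ext j
    obtain ⟨k, rfl⟩ := e.symm.surjective j
    rcases k with i | i
    · exact congrArg Zsqrtd.re (congrFun h i)
    · exact congrArg Zsqrtd.im (congrFun h i)
  obtain ⟨U, hU, h⟩ := hermite_bound m ((reGram G).submatrix e e)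
    ((reGram_isSymm hG).submatrix e) fun v hv => by
      rw [hq]; exact (totPos_iff.1 (hp _ (h0 v hv))).1
  rw [det_submatrix_equiv_self, det_reGram, hq] at h
  refine ⟨_, h0 (fun i => U i 0) fun hc => ?_, h⟩
  rw [det_eq_zero_of_column_eq_zero 0 (congrFun hc)] at hU
  simp at hU

/-- Gram matrices of totally positive definite quadratic forms over `ℤ[√3]` all of whose values
have even `√3`-coefficient. -/
structure IsGood {n : ℕ} (G : Matrix (Fin n) (Fin n) (ℤ√3)) : Prop where
  symm : G.IsSymm
  pos : ∀ v ≠ 0, TotPos (qval G v)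
  even : ∀ v, Even (qval G v).im

lemma IsGood.totPos_diag {n : ℕ} {G : Matrix (Fin n) (Fin n) (ℤ√3)} (hG : IsGood G) (i : Fin n) :
    TotPos (G i i) := by
  rw [← qval_single G i]
  exact hG.pos _ (by simp)

lemma IsGood.conj {n : ℕ} {G U : Matrix (Fin n) (Fin n) (ℤ√3)} (hG : IsGood G) (hU : U.det = 1) :
    IsGood (Uᵀ * G * U) where
  symm := by
    rw [IsSymm, transpose_mul, transpose_mul, transpose_transpose, hG.symm.eq, Matrix.mul_assoc]
  pos v hv := by
    rw [qval_conj]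
    refine hG.pos _ fun h => hv ?_
    exact eq_zero_of_mulVec_eq_zero (by simp [hU]) h
  even v := by
    rw [qval_conj]
    exact hG.even _

lemma det_conj_eq {n : ℕ} {G U : Matrix (Fin n) (Fin n) (ℤ√3)} (hU : U.det = 1) :
    (Uᵀ * G * U).det = G.det := by
  simp [hU]

lemma exists_qval_eq_qval_conj {n : ℕ} (G : Matrix (Fin n) (Fin n) (ℤ√3))
    {U : Matrix (Fin n) (Fin n) (ℤ√3)} (hU : U.det = 1) (v : Fin n → ℤ√3) :
    ∃ w, qval G v = qval (Uᵀ * G * U) w :=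
  ⟨U.adjugate *ᵥ v, by rw [qval_conj, mulVec_mulVec, mul_adjugate, hU, one_smul, one_mulVec]⟩

lemma IsGood.schur {n : ℕ} {G : Matrix (Fin (n + 1)) (Fin (n + 1)) (ℤ√3)} (hG : IsGood G) :
    IsGood (schur G) where
  symm := schur_isSymm hG.symm
  pos v hv := by
    have h0 := hG.totPos_diag 0
    have h := mul_qval_cons hG.symm (-∑ j, G 0 j.succ * v j) (G 0 0 • v)
    have h1 : ∑ j, G 0 j.succ * (G 0 0 • v) j = G 0 0 * ∑ j, G 0 j.succ * v j := by
      rw [Finset.mul_sum]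
      exact Finset.sum_congr rfl fun j _ => by simp; ring
    rw [h1, qval_smul] at h
    have h2 : qval G (Fin.cons (-∑ j, G 0 j.succ * v j) (G 0 0 • v)) =
        G 0 0 * qval (Paper3.schur G) v := by
      apply mul_left_cancel₀ h0.ne_zero
      rw [h]; ring
    refine TotPos.of_mul h0 (h2 ▸ hG.pos _ fun hc => hv ?_)
    have h3 : G 0 0 • v = 0 := by
      ext1 j
      simpa using congrFun hc j.succ
    exact (smul_eq_zero.1 h3).resolve_left h0.ne_zero
  even v := by
    have h := congrArg Zsqrtd.im (mul_qval_cons hG.symm 0 v)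
    have h1 : Even (G 0 0).im := qval_single G 0 ▸ hG.even _
    have h2 := even_im_mul h1 (hG.even (Fin.cons 0 v))
    rw [h, im_add] at h2
    exact (Int.even_add.1 h2).1 (even_im_sq _)

lemma IsGood.det_schur {n : ℕ} {G : Matrix (Fin (n + 2)) (Fin (n + 2)) (ℤ√3)} (hG : IsGood G) :
    (Paper3.schur G).det = G 0 0 ^ n * G.det := by
  apply mul_left_cancel₀ (hG.totPos_diag 0).ne_zero
  rw [Paper3.det_schur hG.symm]; ring

/-- A vector is primitive if only units divide it. -/
def IsPrimitive {n : ℕ} (v : Fin n → ℤ√3) : Prop := ∀ (d : ℤ√3) (w : Fin n → ℤ√3), v = d • w → IsUnit d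

lemma IsPrimitive.exists_basis_two {v : Fin 2 → ℤ√3} (hv : IsPrimitive v) :
    ∃ U : Matrix (Fin 2) (Fin 2) (ℤ√3), U.det = 1 ∧ U *ᵥ Pi.single 0 1 = v := by
  obtain ⟨d, p, r, s, w, h0, h1, h⟩ := exists_bezout (v 0) (v 1)
  obtain ⟨η, hη⟩ := (hv d ![p, r] (by ext1 i; fin_cases i <;> simp [h0, h1])).exists_right_inv
  refine ⟨!![d * p, -(η * w); d * r, η * s], ?_, ?_⟩
  · rw [det_fin_two_of]; linear_combination d * η * h + hη
  · ext1 i; fin_cases i <;> simp [h0, h1]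

lemma IsPrimitive.exists_basis_three {v : Fin 3 → ℤ√3} (hv : IsPrimitive v) :
    ∃ U : Matrix (Fin 3) (Fin 3) (ℤ√3), U.det = 1 ∧ U *ᵥ Pi.single 0 1 = v := by
  obtain ⟨d', p, r, s, w, h1, h2, h⟩ := exists_bezout (v 1) (v 2)
  obtain ⟨d, u, δ, m, l, h0, hd', h'⟩ := exists_bezout (v 0) d'
  subst hd'
  obtain ⟨η, hη⟩ := (hv d ![u, δ * p, δ * r]
    (by ext1 i; fin_cases i <;> simp [h0, h1, h2, mul_assoc])).exists_right_inv
  refine ⟨!![d * u, -l, 0; d * δ * p, p * m, -(η * w); d * δ * r, r * m, η * s], ?_, ?_⟩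
  · simp [det_fin_three]
    linear_combination d * η * (u * m + δ * l) * h + d * η * h' + hη
  · ext1 i; fin_cases i <;> simp [h0, h1, h2]

lemma eq_of_re_le_three {γ : ℤ√3} (hp : TotPos γ) (he : Even γ.im) (h : γ.re ≤ 3) :
    γ = 1 ∨ γ = 2 ∨ γ = 3 := by
  obtain ⟨h1, h2⟩ := totPos_iff.1 hp
  obtain ⟨k, hk⟩ := he
  rw [norm_def, hk] at h2
  have hk0 : k = 0 := by nlinarith [sq_nonneg (k - 1), sq_nonneg (k + 1), sq_nonneg k]
  have him : γ.im = 0 := by omega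
  have : γ.re = 1 ∨ γ.re = 2 ∨ γ.re = 3 := by omega
  simpa [Zsqrtd.ext_iff, him] using this

lemma natAbs_norm_of_sq_mul {d β : ℤ√3} {p : ℕ} (hp : p.Prime) (h : d ^ 2 * β = (p : ℤ√3)) :
    IsUnit d ∨ d.norm.natAbs = p := by
  have h1 := congrArg (fun x => (Zsqrtd.norm x).natAbs) h
  simp only [norm_mul, sq, norm_natCast, Int.natAbs_mul, Int.natAbs_natCast] at h1
  have h2 : d.norm.natAbs ∣ p := by
    rw [← Nat.pow_dvd_pow_iff (n := 2) two_ne_zero]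
    exact ⟨β.norm.natAbs, by rw [sq, sq, ← h1]⟩
  rcases (Nat.dvd_prime hp).1 h2 with h3 | h3
  · exact .inl (norm_eq_one_iff.1 h3)
  · exact .inr h3

lemma isUnit_of_sq_mul_eq_two {d β : ℤ√3} (hβ : Even β.im) (h : d ^ 2 * β = 2) : IsUnit d := by
  refine (natAbs_norm_of_sq_mul Nat.prime_two (by simpa using h)).resolve_right fun hn => ?_
  have hre := congrArg Zsqrtd.re h
  obtain ⟨k, hk⟩ := hβ
  simp [sq, hk] at hre
  rw [norm_def] at hn
  rcases Int.even_or_odd' d.re with ⟨x, hx | hx⟩ <;> rcases Int.even_or_odd' d.im with ⟨y, hy | hy⟩ <;>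
    rw [hx, hy] at hn hre <;> ring_nf at hn hre <;> omega

lemma isUnit_or_of_sq_mul_eq_three {d β : ℤ√3} (h : d ^ 2 * β = 3) :
    IsUnit d ∨ ∃ η, η ^ 2 * β = 1 := by
  refine (natAbs_norm_of_sq_mul Nat.prime_three (by simpa using h)).imp_right fun hn => ?_
  rw [norm_def] at hn
  rw [mul_assoc] at hn
  have h3 : (3 : ℤ) ∣ d.re * d.re := by omega
  obtain ⟨k, hk⟩ := or_self_iff.1 (Int.prime_three.dvd_mul.1 h3)
  refine ⟨⟨d.im, k⟩, ?_⟩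
  have hd : d = ⟨0, 1⟩ * ⟨d.im, k⟩ := by ext <;> simp [hk]
  have hs2 : (⟨0, 1⟩ : ℤ√3) ^ 2 = 3 := by ext <;> simp [sq]
  have h30 : (3 : ℤ√3) ≠ 0 := by simp
  apply mul_left_cancel₀ h30
  rw [hd, mul_pow, hs2] at h
  rw [← mul_assoc, h, mul_one]

lemma isPrimitive_of_eq_one {n : ℕ} {G : Matrix (Fin n) (Fin n) (ℤ√3)} {v : Fin n → ℤ√3}
    (h : qval G v = 1) : IsPrimitive v := by
  rintro d w rfl
  rw [qval_smul, sq, mul_assoc] at h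
  exact IsUnit.of_mul_eq_one _ h

lemma IsGood.isPrimitive_of_eq_two {n : ℕ} {G : Matrix (Fin n) (Fin n) (ℤ√3)} (hG : IsGood G)
    {v : Fin n → ℤ√3} (h : qval G v = 2) : IsPrimitive v := by
  rintro d w rfl
  rw [qval_smul] at h
  exact isUnit_of_sq_mul_eq_two (hG.even w) h

lemma isPrimitive_or_of_eq_three {n : ℕ} {G : Matrix (Fin n) (Fin n) (ℤ√3)}
    {v : Fin n → ℤ√3} (h : qval G v = 3) : IsPrimitive v ∨ ∃ w, qval G w = 1 := by
  by_contra! hc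
  obtain ⟨hv, h1⟩ := hc
  refine hv ?_
  rintro d w rfl
  rw [qval_smul] at h
  refine (isUnit_or_of_sq_mul_eq_three h).resolve_right ?_
  rintro ⟨η, hη⟩
  exact h1 (η • w) (by rw [qval_smul, hη])

/-- If `β ^ 2 ≡ -2` modulo three, then `β` is congruent to `1` or `-1`. -/
lemma exists_three_mul_add_sq_eq_one {β f : ℤ√3} (h : β ^ 2 + 2 = 3 * f) :
    ∃ x, (3 * x + β) ^ 2 = 1 := by
  have h1 := congrArg Zsqrtd.re h
  have h2 := congrArg Zsqrtd.im h
  simp [sq] at h1 h2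
  obtain ⟨b, hb⟩ : (3 : ℤ) ∣ β.im := by
    have hre : ¬ (3 : ℤ) ∣ β.re := by
      rintro ⟨k, hk⟩
      rw [hk] at h1
      ring_nf at h1
      omega
    have : (3 : ℤ) ∣ β.re * β.im := by
      rw [mul_comm β.im] at h2
      omega
    exact (Int.prime_three.dvd_mul.1 this).resolve_left hre
  have hre : β.re % 3 = 1 ∨ β.re % 3 = 2 := by
    by_contra! hc
    obtain ⟨k, hk⟩ : (3 : ℤ) ∣ β.re := by omega
    rw [hk] at h1
    ring_nf at h1
    omega
  obtain ⟨k, hk⟩ : ∃ k, 3 * k + β.re = 1 ∨ 3 * k + β.re = -1 := by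
    rcases hre with h | h
    · exact ⟨-(β.re / 3), by omega⟩
    · exact ⟨-(β.re / 3) - 1, by omega⟩
  refine ⟨⟨k, -b⟩, ?_⟩
  have him : 3 * ⟨k, -b⟩ + β = ((3 * k + β.re : ℤ) : ℤ√3) := by ext <;> simp [hb]
  rw [him]
  rcases hk with hk | hk <;> rw [hk] <;> norm_num

/-- In determinant one, a vector of norm one of the projected form gives one of the form itself,
namely the normal vector of a sublattice of determinant one. -/
lemma exists_eq_one_of_schur {G : Matrix (Fin 3) (Fin 3) (ℤ√3)} (hG : G.IsSymm) (hdet : G.det = 1)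
    {y : Fin 2 → ℤ√3} (h : qval (schur G) y = 1) : ∃ v, qval G v = 1 := by
  refine ⟨G.adjugate *ᵥ ![0, -y 1, y 0], ?_⟩
  have h1 : qval G (G.adjugate *ᵥ ![0, -y 1, y 0]) = qval G.adjugate ![0, -y 1, y 0] := by
    rw [← qval_conj, adjugate_transpose, hG.eq, adjugate_mul, hdet, one_smul, Matrix.one_mul]
  rw [h1, ← h]
  simp only [qval_eq_sum, Fin.sum_univ_succ, Fin.sum_univ_zero, adjugate_fin_three, schur, of_apply]
  simp [hG.apply 0 1, hG.apply 0 2, hG.apply 1 2]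
  ring

/-- Completing the square in a binary form. -/
lemma mul_qval_two {G : Matrix (Fin 2) (Fin 2) (ℤ√3)} (hG : G.IsSymm) (v : Fin 2 → ℤ√3) :
    G 0 0 * qval G v = (G 0 0 * v 0 + G 0 1 * v 1) ^ 2 + G.det * v 1 ^ 2 := by
  simp only [qval_eq_sum, Fin.sum_univ_two, det_fin_two, hG.apply 0 1]
  ring

lemma IsGood.exists_conj_two {G : Matrix (Fin 2) (Fin 2) (ℤ√3)} (hG : IsGood G) {v : Fin 2 → ℤ√3}
    (hv : IsPrimitive v) : ∃ G' : Matrix (Fin 2) (Fin 2) (ℤ√3), IsGood G' ∧ G'.det = G.det ∧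
      G' 0 0 = qval G v ∧ (∀ v, ∃ w, qval G v = qval G' w) ∧ ∀ v, ∃ w, qval G' v = qval G w := by
  obtain ⟨U, hU, hUv⟩ := hv.exists_basis_two
  exact ⟨_, hG.conj hU, det_conj_eq hU, by rw [← qval_single (Uᵀ * G * U), qval_conj, hUv],
    exists_qval_eq_qval_conj G hU, fun w => ⟨_, qval_conj G U w⟩⟩

lemma IsGood.exists_conj_three {G : Matrix (Fin 3) (Fin 3) (ℤ√3)} (hG : IsGood G)
    {v : Fin 3 → ℤ√3} (hv : IsPrimitive v) : ∃ G' : Matrix (Fin 3) (Fin 3) (ℤ√3), IsGood G' ∧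
      G'.det = G.det ∧ G' 0 0 = qval G v ∧ (∀ v, ∃ w, qval G v = qval G' w) ∧
      ∀ v, ∃ w, qval G' v = qval G w := by
  obtain ⟨U, hU, hUv⟩ := hv.exists_basis_three
  exact ⟨_, hG.conj hU, det_conj_eq hU, by rw [← qval_single (Uᵀ * G * U), qval_conj, hUv],
    exists_qval_eq_qval_conj G hU, fun w => ⟨_, qval_conj G U w⟩⟩

lemma IsGood.exists_of_det_eq_two {G : Matrix (Fin 2) (Fin 2) (ℤ√3)} (hG : IsGood G)
    (hdet : G.det = 2) : ∃ v, qval G v = 1 ∨ qval G v = 2 := by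
  obtain ⟨v, hv, h⟩ := exists_re_qval_le (m := 3) rfl hG.symm hG.pos
  have hN : (2 : ℤ√3).norm = 4 := by simp [norm_def]
  have hle : (qval G v).re ≤ 3 := by
    simp only [hdet, hN, Finset.sum_range_succ, Finset.sum_range_zero] at h
    by_contra! hc
    have : 4 ^ (3 + 1) ≤ (qval G v).re ^ (3 + 1) := by gcongr; omega
    omega
  rcases eq_of_re_le_three (hG.pos v hv) (hG.even v) hle with h1 | h1 | h1
  · exact ⟨v, .inl h1⟩
  · exact ⟨v, .inr h1⟩
  · rcases isPrimitive_or_of_eq_three h1 with hp | ⟨w, hw⟩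
    · obtain ⟨G', hG', hdet', h00, -, hval⟩ := hG.exists_conj_two hp
      rw [h1] at h00
      have key := fun x => mul_qval_two hG'.symm ![x, 1]
      simp only [h00, hdet', hdet, cons_val_zero, cons_val_one, mul_one, one_pow] at key
      obtain ⟨x, hx⟩ := exists_three_mul_add_sq_eq_one (β := G' 0 1)
        ((key 0).trans (by ring)).symm
      obtain ⟨w, hw⟩ := hval ![x, 1]
      refine ⟨w, .inl ?_⟩
      have h30 : (3 : ℤ√3) ≠ 0 := by simp
      apply mul_left_cancel₀ h30
      rw [← hw, key, hx]; norm_num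
    · exact ⟨w, .inl hw⟩

lemma IsGood.exists_eq_one_of_eq_two {G : Matrix (Fin 3) (Fin 3) (ℤ√3)} (hG : IsGood G)
    (hdet : G.det = 1) (h2 : ∃ v, qval G v = 2) : ∃ v, qval G v = 1 := by
  obtain ⟨v, hv⟩ := h2
  obtain ⟨G', hG', hdet', h00, -, hval⟩ := hG.exists_conj_three (hG.isPrimitive_of_eq_two hv)
  rw [hv] at h00
  rw [hdet] at hdet'
  suffices ∃ v, qval G' v = 1 by
    obtain ⟨v, hv⟩ := this
    obtain ⟨w, hw⟩ := hval v
    exact ⟨w, hw ▸ hv⟩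
  obtain ⟨y, hy | hy⟩ := hG'.schur.exists_of_det_eq_two (by rw [hG'.det_schur, h00, hdet']; norm_num)
  · exact exists_eq_one_of_schur hG'.symm hdet' hy
  · have key := fun x => mul_qval_cons hG'.symm x y
    simp only [h00, hy] at key
    set β := ∑ j, G' 0 j.succ * y j
    have h := key 0
    obtain ⟨k, hk⟩ := hG'.even (Fin.cons 0 y)
    have h1 := congrArg Zsqrtd.re h
    have h2 := congrArg Zsqrtd.im h
    simp [sq, hk] at h1 h2
    rcases Int.even_or_odd' β.re with ⟨b, hb | hb⟩ <;>
      rcases Int.even_or_odd' β.im with ⟨c, hc | hc⟩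
    · refine ⟨Fin.cons (-⟨b, c⟩) y, ?_⟩
      have h20 : (2 : ℤ√3) ≠ 0 := by simp
      apply mul_left_cancel₀ h20
      have : 2 * -⟨b, c⟩ + β = 0 := by ext <;> simp [hb, hc]
      rw [key, this]; norm_num
    all_goals
      exfalso
      rw [hb, hc] at h1 h2
      ring_nf at h1 h2
      omega

lemma IsGood.exists_of_det_eq_three {G : Matrix (Fin 2) (Fin 2) (ℤ√3)} (hG : IsGood G)
    (hdet : G.det = 3) : ∃ v ≠ 0, (qval G v).re ≤ 4 := by
  obtain ⟨v, hv, h⟩ := exists_re_qval_le (m := 3) rfl hG.symm hG.pos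
  have hN : (3 : ℤ√3).norm = 9 := by simp [norm_def]
  refine ⟨v, hv, ?_⟩
  simp only [hdet, hN, Finset.sum_range_succ, Finset.sum_range_zero] at h
  by_contra! hc
  have : 5 ^ (3 + 1) ≤ (qval G v).re ^ (3 + 1) := by gcongr; omega
  omega

lemma IsGood.exists_eq_one_of_eq_three {G : Matrix (Fin 3) (Fin 3) (ℤ√3)} (hG : IsGood G)
    (hdet : G.det = 1) (h3 : ∃ v, qval G v = 3) : ∃ v, qval G v = 1 := by
  obtain ⟨v, hv⟩ := h3
  rcases isPrimitive_or_of_eq_three hv with hp | hw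
  swap
  · exact hw
  obtain ⟨G', hG', hdet', h00, -, hval⟩ := hG.exists_conj_three hp
  rw [hv] at h00
  rw [hdet] at hdet'
  suffices ∃ v, qval G' v = 1 by
    obtain ⟨v, hv⟩ := this
    obtain ⟨w, hw⟩ := hval v
    exact ⟨w, hw ▸ hv⟩
  obtain ⟨y, hy0, hle⟩ :=
    hG'.schur.exists_of_det_eq_three (by rw [hG'.det_schur, h00, hdet']; norm_num)
  have hp := hG'.schur.pos y hy0
  have he := hG'.schur.even y
  have key := fun x => mul_qval_cons hG'.symm x y
  simp only [h00] at key
  have h30 : (3 : ℤ√3) ≠ 0 := by simp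
  set β := ∑ j, G' 0 j.succ * y j
  set γ := qval (Paper3.schur G') y
  have h := key 0
  rw [mul_zero, zero_add] at h
  have h1 := congrArg Zsqrtd.re h
  have h2 := congrArg Zsqrtd.im h
  simp [sq] at h1 h2
  have hγ3 : γ.re ≤ 3 := by
    by_contra! hc
    obtain ⟨b, c, hb, hc⟩ : ∃ b c, β.re = 3 * b + c ∧ (c = 0 ∨ c = 1 ∨ c = 2) :=
      ⟨β.re / 3, β.re % 3, by omega, by omega⟩
    rcases hc with rfl | rfl | rfl <;> rw [hb] at h1 <;> ring_nf at h1 <;> omega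
  rcases eq_of_re_le_three hp he hγ3 with hγ | hγ | hγ
  · exact exists_eq_one_of_schur hG'.symm hdet' hγ
  · rw [hγ] at key h
    obtain ⟨x, hx⟩ := exists_three_mul_add_sq_eq_one h.symm
    refine ⟨Fin.cons x y, mul_left_cancel₀ h30 ?_⟩
    rw [key, hx]; norm_num
  · rw [hγ] at key h1
    obtain ⟨b, hb⟩ : (3 : ℤ) ∣ β.re := by
      have : (3 : ℤ) ∣ β.re * β.re := by
        rw [mul_assoc] at h1
        simp at h1
        omega
      exact or_self_iff.1 (Int.prime_three.dvd_mul.1 this)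
    obtain ⟨c, d, hd, hc⟩ : ∃ c d, β.im = 3 * c + d ∧ (d = 0 ∨ d = 1 ∨ d = -1) := by
      have : β.im % 3 = 0 ∨ β.im % 3 = 1 ∨ β.im % 3 = 2 := by omega
      rcases this with h | h | h
      · exact ⟨β.im / 3, 0, by omega, by simp⟩
      · exact ⟨β.im / 3, 1, by omega, by simp⟩
      · exact ⟨β.im / 3 + 1, -1, by omega, by simp⟩
    have hval : 3 * qval G' (Fin.cons (-⟨b, c⟩) y) = 3 * (d ^ 2 + 1) := by
      rw [key]
      have : 3 * -⟨b, c⟩ + β = ⟨0, d⟩ := by ext <;> simp [hb, hd]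
      rw [this]
      ext <;> simp [sq]
      ring
    have hval' := mul_left_cancel₀ h30 hval
    rcases hc with rfl | hc
    · exact ⟨_, hval'.trans (by simp)⟩
    · refine hG'.exists_eq_one_of_eq_two hdet' ⟨_, hval'.trans ?_⟩
      rcases hc with rfl | rfl <;> norm_num

lemma IsGood.exists_eq_one {G : Matrix (Fin 3) (Fin 3) (ℤ√3)} (hG : IsGood G) (hdet : G.det = 1) :
    ∃ v, qval G v = 1 := by
  obtain ⟨v, hv, h⟩ := exists_re_qval_le (m := 5) rfl hG.symm hG.pos
  have hle : (qval G v).re ≤ 3 := by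
    simp only [hdet, Zsqrtd.norm_one, Finset.sum_range_succ, Finset.sum_range_zero] at h
    by_contra! hc
    have : 4 ^ (5 + 1) ≤ (qval G v).re ^ (5 + 1) := by gcongr; omega
    omega
  rcases eq_of_re_le_three (hG.pos v hv) (hG.even v) hle with h1 | h1 | h1
  · exact ⟨v, h1⟩
  · exact hG.exists_eq_one_of_eq_two hdet ⟨v, h1⟩
  · exact hG.exists_eq_one_of_eq_three hdet ⟨v, h1⟩

lemma exists_eq_mul_of_even {x : ℤ√3} (h : Even (x.re + x.im)) : ∃ z, x = ⟨1, 1⟩ * z := by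
  obtain ⟨k, hk⟩ := h
  refine ⟨⟨2 * x.im - k, k - x.im⟩, ?_⟩
  ext <;> simp <;> omega

/-- The form `2 (x² + √3 x y + y²)` represents only sums of two squares. -/
lemma exists_sq_add_sq_eq_two_mul (x y : ℤ√3) :
    ∃ r s, r ^ 2 + s ^ 2 = 2 * (x ^ 2 + ⟨0, 1⟩ * x * y + y ^ 2) := by
  have hs : (⟨0, 1⟩ : ℤ√3) ^ 2 = 3 := by ext <;> simp [sq]
  have h1 : (⟨1, 1⟩ : ℤ√3) = 1 + ⟨0, 1⟩ := by ext <;> simp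
  have key : ∀ x y : ℤ√3, Even (y.re + y.im) →
      ∃ r s, r ^ 2 + s ^ 2 = 2 * (x ^ 2 + ⟨0, 1⟩ * x * y + y ^ 2) := by
    intro x y hy
    obtain ⟨z, rfl⟩ := exists_eq_mul_of_even hy
    refine ⟨x + (2 + ⟨0, 1⟩) * z, x + z, ?_⟩
    rw [h1]
    linear_combination (-2 * x * z - z ^ 2) * hs
  by_cases hy : Even (y.re + y.im)
  · exact key x y hy
  by_cases hx : Even (x.re + x.im)
  · obtain ⟨r, s, h⟩ := key y x hx
    exact ⟨r, s, by rw [h]; ring⟩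
  · obtain ⟨r, s, h⟩ := key (-y) (x + ⟨0, 1⟩ * y) (by
      simp
      rw [Int.not_even_iff] at hx hy
      rw [Int.even_iff]
      omega)
    exact ⟨r, s, by rw [h]; ring⟩

lemma IsGood.exists_sq_add_sq {G : Matrix (Fin 2) (Fin 2) (ℤ√3)} (hG : IsGood G)
    (hdet : G.det = 1) (v : Fin 2 → ℤ√3) : ∃ r s, r ^ 2 + s ^ 2 = qval G v := by
  obtain ⟨u, hu, h⟩ := exists_re_qval_le (m := 3) rfl hG.symm hG.pos
  have hle : (qval G u).re ≤ 2 := by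
    simp only [hdet, Zsqrtd.norm_one, Finset.sum_range_succ, Finset.sum_range_zero] at h
    by_contra! hc
    have : 3 ^ (3 + 1) ≤ (qval G u).re ^ (3 + 1) := by gcongr; omega
    omega
  have h12 : qval G u = 1 ∨ qval G u = 2 := by
    rcases eq_of_re_le_three (hG.pos u hu) (hG.even u) (by omega) with h1 | h1 | h1
    · exact .inl h1
    · exact .inr h1
    · simp [h1] at hle
  have hprim : IsPrimitive u := h12.elim isPrimitive_of_eq_one hG.isPrimitive_of_eq_two
  obtain ⟨G', hG', hdet', h00, hval, -⟩ := hG.exists_conj_two hprim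
  rw [hdet] at hdet'
  obtain ⟨w, hw⟩ := hval v
  rw [hw]
  have key := mul_qval_two hG'.symm w
  rw [hdet', one_mul] at key
  rcases h12 with h1 | h1 <;> rw [h00, h1] at key
  · rw [one_mul] at key
    exact ⟨_, _, key.symm⟩
  · have h20 : (2 : ℤ√3) ≠ 0 := by simp
    have hd := hdet'
    rw [det_fin_two, h00, h1, hG'.symm.apply 0 1] at hd
    generalize G' 0 1 = β at key hd
    generalize G' 1 1 = δ at hd
    have h3 := congrArg Zsqrtd.re hd
    simp at h3
    rcases Int.even_or_odd' β.re with ⟨b, hb | hb⟩ <;>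
      rcases Int.even_or_odd' β.im with ⟨c, hc | hc⟩
    · exfalso
      rw [hb, hc] at h3
      ring_nf at h3
      omega
    · have hβ : β = ⟨0, 1⟩ + 2 * ⟨b, c⟩ := by ext <;> simp [hb, hc]; ring
      obtain ⟨r, s, h⟩ := exists_sq_add_sq_eq_two_mul (w 0 + ⟨b, c⟩ * w 1) (w 1)
      have hs : (⟨0, 1⟩ : ℤ√3) ^ 2 = 3 := by ext <;> simp [sq]
      refine ⟨r, s, h.trans ?_⟩
      apply mul_left_cancel₀ h20
      rw [key, hβ]
      linear_combination (-w 1 ^ 2) * hs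
    · have hβ : β = 1 + 2 * ⟨b, c⟩ := by ext <;> simp [hb, hc]; ring
      refine ⟨w 0 + (⟨b, c⟩ + 1) * w 1, w 0 + ⟨b, c⟩ * w 1, ?_⟩
      apply mul_left_cancel₀ h20
      rw [key, hβ]
      ring
    · exfalso
      rw [hb, hc] at h3
      ring_nf at h3
      omega

lemma IsGood.exists_three_squares {G : Matrix (Fin 3) (Fin 3) (ℤ√3)} (hG : IsGood G)
    (hdet : G.det = 1) (v : Fin 3 → ℤ√3) : ∃ x y z, x ^ 2 + y ^ 2 + z ^ 2 = qval G v := by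
  obtain ⟨u, hu⟩ := hG.exists_eq_one hdet
  obtain ⟨G', hG', hdet', h00, hval, -⟩ := hG.exists_conj_three (isPrimitive_of_eq_one hu)
  rw [hu] at h00
  obtain ⟨w, hw⟩ := hval v
  obtain ⟨r, s, h⟩ := hG'.schur.exists_sq_add_sq (by rw [hG'.det_schur, h00, hdet', hdet]; norm_num)
    (Fin.tail w)
  have key := mul_qval_cons hG'.symm (w 0) (Fin.tail w)
  rw [h00, one_mul, Fin.cons_self_tail, ← h] at key
  exact ⟨_, r, s, by rw [hw, key, add_assoc]⟩

lemma exists_isGood {n : ℤ√3} (hn : TotPos n) (hne : Even n.im) :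
    ∃ G : Matrix (Fin 3) (Fin 3) (ℤ√3), IsGood G ∧ G.det = 1 ∧ G 2 2 = n := by
  obtain ⟨q, t, b, a, c, hq, hnb, hbe, hbp, hc⟩ := exists_auxiliary hn
  have hqp : TotPos (q : ℤ√3) := by
    have : 0 < q := hq.pos
    simpa [TotPos, emb, embConj] using this
  have hce : Even c.im := by
    have h := congrArg Zsqrtd.im hc
    have h1 : Even (a ^ 2 + b).im := by rw [im_add]; exact (even_im_sq a).add hbe
    rw [h] at h1
    have h2 : ¬ Even (q : ℤ) := by simpa using hq
    simpa [Int.even_mul, h2] using h1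
  have hval : ∀ v, qval !![c, a, t; a, (q : ℤ√3), 0; t, 0, n] v = c * v 0 ^ 2 + q * v 1 ^ 2 +
      n * v 2 ^ 2 + 2 * (a * v 0 * v 1 + t * v 0 * v 2) := by
    intro v
    simp [qval_eq_sum, Fin.sum_univ_three]
    ring
  refine ⟨!![c, a, t; a, q, 0; t, 0, n], ⟨?_, ?_, ?_⟩, ?_, rfl⟩
  · exact IsSymm.ext fun i j => by fin_cases i <;> fin_cases j <;> rfl
  · intro v hv
    rw [hval]
    refine (hbp.mul hqp).of_mul ?_
    have h : b * q * (c * v 0 ^ 2 + q * v 1 ^ 2 + n * v 2 ^ 2 +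
        2 * (a * v 0 * v 1 + t * v 0 * v 2)) = b * (a * v 0 + q * v 1) ^ 2 +
          (b * v 0 + q * t * v 2) ^ 2 + q * v 2 ^ 2 := by
      linear_combination (-b * v 0 ^ 2) * hc + (q * v 2 ^ 2) * hnb
    rw [h]
    have hb0 := hbp.ne_zero
    have hq0 := hqp.ne_zero
    have hsq : ∀ {d : ℤ√3}, TotPos d → ∀ x, d * x ^ 2 = 0 ∨ TotPos (d * x ^ 2) := fun {d} hd x => by
      by_cases hx : x = 0
      · exact .inl (by simp [hx])
      · exact .inr (hd.mul (totPos_sq hx))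
    have hone : TotPos 1 := by simp [TotPos, emb, embConj]
    have h1 := hsq hbp (a * v 0 + q * v 1)
    have h2 := hsq hone (b * v 0 + q * t * v 2)
    have h3 := hsq hqp (v 2)
    rw [one_mul] at h2
    rcases h3 with h3 | h3
    · have hv2 : v 2 = 0 := by simpa [hq0] using h3
      rw [h3, add_zero]
      rcases h2 with h2 | h2
      · have hv0 : v 0 = 0 := by simpa [hb0, hv2] using h2
        rw [h2, add_zero]
        refine h1.resolve_left fun h1 => hv ?_
        have hv1 : v 1 = 0 := by simpa [hb0, hq0, hv0] using h1
        ext1 i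
        fin_cases i <;> simp [hv0, hv1, hv2]
      · rcases h1 with h1 | h1
        · rwa [h1, zero_add]
        · exact h1.add h2
    · rcases h1 with h1 | h1 <;> rcases h2 with h2 | h2
      · rwa [h1, h2, zero_add, zero_add]
      · rw [h1, zero_add]
        exact h2.add h3
      · rw [h2, add_zero]
        exact h1.add h3
      · exact (h1.add h2).add h3
  · intro v
    rw [hval]
    have h2 : Even (2 * (a * v 0 * v 1 + t * v 0 * v 2) : ℤ√3).im := by simp
    simp only [im_add] at h2 ⊢
    refine (((even_im_mul hce (even_im_sq _)).add (even_im_mul (by simp) (even_im_sq _))).add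
      (even_im_mul hne (even_im_sq _))).add h2
  · simp [det_fin_three]
    linear_combination -n * hc + hnb

/-- A totally positive a + b√3 is a sum of three squares in ℤ[√3]
if and only if b is even. -/
theorem sum_three_squares_iff_even (a b : ℤ) (hpos : TotPos ⟨a, b⟩) :
    (∃ x y z : Zsqrtd 3, x ^ 2 + y ^ 2 + z ^ 2 = (⟨a, b⟩ : Zsqrtd 3)) ↔ Even b := by
  constructor
  · rintro ⟨x, y, z, h⟩
    have him : (x ^ 2 + y ^ 2 + z ^ 2).im = b := congrArg Zsqrtd.im h
    rw [← him, im_add, im_add]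
    exact ((even_im_sq x).add (even_im_sq y)).add (even_im_sq z)
  · intro hb
    obtain ⟨G, hG, hdet, h22⟩ := exists_isGood hpos hb
    rw [← h22, ← qval_single G 2]
    exact hG.exists_three_squares hdet _

end Paper3
end
end

section
/- Let ν = a + b√3 ∈ O_K be totally positive and let v be the exponent of 𝔭₂ in the ideal (ν). If v is odd, or if v = 0 and b is odd, then ν is not a sum of two squares in O_K (i.e., r_{2,K}(ν) = 0). -/
/-!
Statements about sums of squares in K = ℚ(√3), with ring of integers O_K = ℤ[√3],
realized as `Zsqrtd 3`.
-/

noncomputable section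

namespace Paper3

/-- `r2 ν` is the number of pairs (x₁,x₂) ∈ O_K² with x₁² + x₂² = ν. -/
def r2 (ν : Zsqrtd 3) : ℕ :=
  Set.ncard {t : Zsqrtd 3 × Zsqrtd 3 | t.1 ^ 2 + t.2 ^ 2 = ν}

/-- The prime ideal 𝔭₂ = (π₂) of O_K, with (2) = 𝔭₂². -/
def p2 : Ideal (Zsqrtd 3) := Ideal.span {pi2}

theorem pi2_dvd_iff (x : Zsqrtd 3) : pi2 ∣ x ↔ Even (x.re + x.im) := by
  constructor
  · rintro ⟨y, rfl⟩
    refine ⟨y.re + 2 * y.im, ?_⟩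
    simp only [pi2, Zsqrtd.re_mul, Zsqrtd.im_mul]
    ring
  · rintro ⟨k, hk⟩
    refine ⟨⟨2 * x.im - k, k - x.im⟩, ?_⟩
    ext <;> simp only [pi2, Zsqrtd.re_mul, Zsqrtd.im_mul] <;> linarith

theorem isLeftRegular_pi2 : IsLeftRegular pi2 := by
  intro x y h
  have h1 := congrArg Zsqrtd.re h
  have h2 := congrArg Zsqrtd.im h
  simp only [pi2, Zsqrtd.re_mul, Zsqrtd.im_mul] at h1 h2
  ext <;> linarith

theorem pi2_sq_mul_dvd_mul_iff {a b : Zsqrtd 3} : pi2 ^ 2 * a ∣ pi2 ^ 2 * b ↔ a ∣ b := by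
  refine ⟨fun ⟨c, hc⟩ => ⟨c, isLeftRegular_pi2.pow 2 ?_⟩, mul_dvd_mul_left _⟩
  simpa only [mul_assoc] using hc

/-- The norm form of `ℤ[√3, ω]` over `ℤ[√3]` (`ω` a primitive sixth root of unity) is
anisotropic modulo `π₂`. -/
theorem pi2_dvd_of_dvd_normForm {α β : Zsqrtd 3} (h : pi2 ∣ α ^ 2 + α * β + β ^ 2) :
    pi2 ∣ α ∧ pi2 ∣ β := by
  simp only [pi2_dvd_iff, sq, Zsqrtd.re_add, Zsqrtd.im_add, Zsqrtd.re_mul, Zsqrtd.im_mul] at *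
  have h3 : ¬ Even (3 : ℤ) := by decide
  simp only [Int.even_add, Int.even_mul, h3] at *
  by_cases h1 : Even α.re <;> by_cases h2 : Even α.im <;> by_cases h4 : Even β.re <;>
    by_cases h5 : Even β.im <;> simp_all [-Int.not_even_iff_odd]

theorem pi2_pow_dvd_normForm (k : ℕ) (α β : Zsqrtd 3)
    (h : pi2 ^ (2 * k + 1) ∣ α ^ 2 + α * β + β ^ 2) :
    pi2 ^ (2 * k + 2) ∣ α ^ 2 + α * β + β ^ 2 := by
  induction k generalizing α β with
  | zero =>
    obtain ⟨⟨a, rfl⟩, ⟨b, rfl⟩⟩ := pi2_dvd_of_dvd_normForm (by simpa using h)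
    exact ⟨a ^ 2 + a * b + b ^ 2, by ring⟩
  | succ k ih =>
    obtain ⟨⟨a, rfl⟩, ⟨b, rfl⟩⟩ :=
      pi2_dvd_of_dvd_normForm ((dvd_pow_self pi2 (Nat.succ_ne_zero _)).trans h)
    have e : (pi2 * a) ^ 2 + pi2 * a * (pi2 * b) + (pi2 * b) ^ 2 =
        pi2 ^ 2 * (a ^ 2 + a * b + b ^ 2) := by ring
    rw [e, show 2 * (k + 1) + 1 = 2 + (2 * k + 1) by ring, pow_add,
      pi2_sq_mul_dvd_mul_iff] at h
    rw [e, show 2 * (k + 1) + 2 = 2 + (2 * k + 2) by ring, pow_add, pi2_sq_mul_dvd_mul_iff]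
    exact ih a b h

theorem isCoprime_pi2_three : IsCoprime pi2 (3 : Zsqrtd 3) := by
  refine ⟨⟨1, -1⟩, 1, ?_⟩
  ext <;> simp [pi2]

theorem pi2_pow_dvd_sq_add_sq (k : ℕ) (x y : Zsqrtd 3) (h : pi2 ^ (2 * k + 1) ∣ x ^ 2 + y ^ 2) :
    pi2 ^ (2 * k + 2) ∣ x ^ 2 + y ^ 2 := by
  have hs : (Zsqrtd.sqrtd : Zsqrtd 3) ^ 2 = 3 := by
    ext <;> simp [sq]
  have e : 3 * (x ^ 2 + y ^ 2) = (Zsqrtd.sqrtd * x - y) ^ 2 +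
      (Zsqrtd.sqrtd * x - y) * (2 * y) + (2 * y) ^ 2 := by
    linear_combination -x ^ 2 * hs
  refine isCoprime_pi2_three.pow_left.dvd_of_dvd_mul_left ?_
  rw [e]
  apply pi2_pow_dvd_normForm
  rw [← e]
  exact h.mul_left 3

theorem even_im_sq_add_sq (x y : Zsqrtd 3) : Even (x ^ 2 + y ^ 2).im := by
  refine ⟨x.re * x.im + y.re * y.im, ?_⟩
  simp only [sq, Zsqrtd.im_add, Zsqrtd.im_mul]
  ring

theorem p2_pow_dvd_span_iff (n : ℕ) (ν : Zsqrtd 3) :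
    p2 ^ n ∣ Ideal.span {ν} ↔ pi2 ^ n ∣ ν := by
  rw [p2, Ideal.span_singleton_pow]
  constructor
  · intro h
    exact Ideal.span_singleton_le_span_singleton.mp (Ideal.le_of_dvd h)
  · rintro ⟨c, rfl⟩
    exact ⟨Ideal.span {c}, (Ideal.span_singleton_mul_span_singleton _ _).symm⟩

/-- Let ν = a + b√3 be totally positive and let v be the exponent of
𝔭₂ in (ν). If v is odd, or v = 0 and b is odd, then ν is not a sum of two squares. -/
theorem not_sum_two_squares (ν : Zsqrtd 3) (v : ℕ) (hpos : TotPos ν)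
    (hv1 : p2 ^ v ∣ Ideal.span {ν}) (hv2 : ¬ p2 ^ (v + 1) ∣ Ideal.span {ν})
    (h : Odd v ∨ (v = 0 ∧ Odd ν.im)) :
    r2 ν = 0 := by
  rw [p2_pow_dvd_span_iff] at hv1 hv2
  have hempty : {t : Zsqrtd 3 × Zsqrtd 3 | t.1 ^ 2 + t.2 ^ 2 = ν} = ∅ := by
    rw [Set.eq_empty_iff_forall_notMem]
    rintro ⟨x, y⟩ rfl
    rcases h with ⟨k, rfl⟩ | ⟨-, hodd⟩
    · exact hv2 (pi2_pow_dvd_sq_add_sq k x y hv1)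
    · exact Int.not_even_iff_odd.mpr hodd (even_im_sq_add_sq x y)
  rw [r2, hempty, Set.ncard_empty]

end Paper3
end
end
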